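/- Let V be a finite-dimensional complex inner product space and X₁,…,X_κ : V → V pairwise commuting self-adjoint linear maps (κ ≥ 1). Let λ ∈ ℝ^κ and let m := dim{v ∈ V : X_k v = λ_k v for all k} be the dimension of the joint eigenspace. Then for each 0 ≤ j ≤ κ the j-th cohomology of the Koszul complex satisfies dim( ker(d_{X−λ}|_{VΛ^j}) / ran(d_{X−λ}|_{VΛ^{j−1}}) ) = m·binom(κ,j); in particular the Euler characteristic (index) Σ_{j=0}^κ (−1)^j dim( ker(d_{X−λ}|_{VΛ^j}) / ran(d_{X−λ}|_{VΛ^{j−1}}) ) equals 0. -/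

import Mathlib

open TensorProduct

/-- `VΛ := V ⊗ ⋀(ℂ^κ)`, the tensor product of `V` with the exterior algebra of `ℂ^κ`. -/
noncomputable abbrev VLambda (κ : ℕ) (V : Type*) [AddCommGroup V] [Module ℂ V] :=
  TensorProduct ℂ V (ExteriorAlgebra ℂ (Fin κ → ℂ))

/-- The Koszul differential `d_X` on `V ⊗ ⋀(ℂ^κ)`, determined by
`d_X (u ⊗ ω) = Σ_k (X_k u) ⊗ (e_k ∧ ω)`. -/
noncomputable def koszulD {κ : ℕ} {V : Type*} [AddCommGroup V] [Module ℂ V]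
    (X : Fin κ → Module.End ℂ V) :
    VLambda κ V →ₗ[ℂ] VLambda κ V :=
  ∑ k : Fin κ, TensorProduct.map (X k)
    (LinearMap.mulLeft ℂ (ExteriorAlgebra.ι ℂ (Pi.single k (1 : ℂ))))

/-- The degree-`j` piece `VΛ^j = V ⊗ ⋀^j(ℂ^κ)` of `V ⊗ ⋀(ℂ^κ)`, as a submodule. -/
noncomputable def degreePiece (κ : ℕ) (V : Type*) [AddCommGroup V] [Module ℂ V] (j : ℕ) :
    Submodule ℂ (VLambda κ V) :=
  LinearMap.range (TensorProduct.map (LinearMap.id : V →ₗ[ℂ] V)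
    (⋀[ℂ]^j (Fin κ → ℂ)).subtype)

open Module in
/-- A semisimple endomorphism has a generalized inverse that is a polynomial in it. -/
theorem Module.End.IsSemisimple.exists_aeval_mul_eq_zero {W : Type*} [AddCommGroup W] [Module ℂ W]
    [FiniteDimensional ℂ W] {T : End ℂ W} (hT : T.IsSemisimple) :
    ∃ g : Polynomial ℂ, T * (1 - Polynomial.aeval T g * T) = 0 := by
  have hsq := hT.minpoly_squarefree
  have hm := minpoly.aeval ℂ T
  have key : ∀ q : Polynomial ℂ, IsCoprime Polynomial.X q →
      T * Polynomial.aeval T q = 0 →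
      ∃ g : Polynomial ℂ, T * (1 - Polynomial.aeval T g * T) = 0 := by
    rintro q ⟨a, b, hab⟩ hq
    refine ⟨a, ?_⟩
    have h1 : 1 - Polynomial.aeval T a * T = Polynomial.aeval T q * Polynomial.aeval T b := by
      have := congrArg (Polynomial.aeval T) hab
      simp only [map_add, map_mul, Polynomial.aeval_X, map_one] at this
      rw [← this, add_sub_cancel_left, ← map_mul, ← map_mul, mul_comm]
    rw [h1, ← mul_assoc, hq, zero_mul]
  by_cases hX : Polynomial.X ∣ minpoly ℂ T
  · obtain ⟨q, hq⟩ := hX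
    refine key q ?_ ?_
    · rw [hq] at hsq
      exact (squarefree_mul_iff.mp hsq).1.isCoprime
    · rw [hq, map_mul, Polynomial.aeval_X] at hm
      exact hm
  · refine key (minpoly ℂ T) ?_ (by rw [hm, mul_zero])
    exact (Polynomial.prime_X.irreducible.coprime_iff_not_dvd).mpr hX

namespace ExteriorAlgebra

variable {R M : Type*} [CommRing R] [AddCommGroup M] [Module R M]

theorem contractLeft_eq_zero_of_mem_exteriorPower_zero (f : Module.Dual R M)
    {x : ExteriorAlgebra R M} (hx : x ∈ ⋀[R]^0 M) :
    CliffordAlgebra.contractLeft f x = 0 := by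
  rw [exteriorPower, pow_zero, Submodule.mem_one] at hx
  obtain ⟨r, rfl⟩ := hx
  exact CliffordAlgebra.contractLeft_algebraMap _ _ _

theorem contractLeft_mem_exteriorPower (f : Module.Dual R M) (n : ℕ)
    {x : ExteriorAlgebra R M} (hx : x ∈ ⋀[R]^(n + 1) M) :
    CliffordAlgebra.contractLeft f x ∈ ⋀[R]^n M := by
  induction n generalizing x with
  | zero =>
    rw [exteriorPower, zero_add, pow_one] at hx
    obtain ⟨m, rfl⟩ := hx
    rw [exteriorPower, pow_zero, Submodule.mem_one]
    exact ⟨f m, (CliffordAlgebra.contractLeft_ι _ _ _).symm⟩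
  | succ n ih =>
    rw [exteriorPower, pow_succ'] at hx
    refine Submodule.mul_induction_on hx ?_ ?_
    · rintro _ ⟨m, rfl⟩ y hy
      rw [CliffordAlgebra.contractLeft_ι_mul]
      refine Submodule.sub_mem _ (Submodule.smul_mem _ _ hy) ?_
      rw [exteriorPower, pow_succ']
      exact Submodule.mul_mem_mul ⟨m, rfl⟩ (ih hy)
    · intro x y hx hy
      rw [map_add]
      exact Submodule.add_mem _ hx hy

end ExteriorAlgebra

section Koszul

variable {κ : ℕ} {V : Type*} [AddCommGroup V] [Module ℂ V]

/-- The contraction operator `Σ_k Y_k ⊗ (e_k^* ⌟ ·)`, dual to the Koszul differential. -/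
noncomputable def koszulContraction (Y : Fin κ → Module.End ℂ V) :
    VLambda κ V →ₗ[ℂ] VLambda κ V :=
  ∑ k : Fin κ, TensorProduct.map (Y k)
    (CliffordAlgebra.contractLeft (LinearMap.proj k : Module.Dual ℂ (Fin κ → ℂ)))

theorem koszulD_tmul (Y : Fin κ → Module.End ℂ V) (v : V) (w : ExteriorAlgebra ℂ (Fin κ → ℂ)) :
    koszulD Y (v ⊗ₜ w) =
      ∑ k, Y k v ⊗ₜ[ℂ] (ExteriorAlgebra.ι ℂ (Pi.single k (1 : ℂ)) * w) := by
  simp [koszulD, LinearMap.sum_apply]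

theorem koszulContraction_tmul (Y : Fin κ → Module.End ℂ V) (v : V)
    (w : ExteriorAlgebra ℂ (Fin κ → ℂ)) :
    koszulContraction Y (v ⊗ₜ w) = ∑ k, Y k v ⊗ₜ[ℂ]
      (CliffordAlgebra.contractLeft (LinearMap.proj k : Module.Dual ℂ (Fin κ → ℂ)) w) := by
  simp [koszulContraction, LinearMap.sum_apply]

theorem koszulD_koszulContraction_add {Y : Fin κ → Module.End ℂ V}
    (hY : ∀ i j, Y i * Y j = Y j * Y i) (z : VLambda κ V) :
    koszulD Y (koszulContraction Y z) + koszulContraction Y (koszulD Y z) =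
      LinearMap.rTensor _ (∑ k, Y k * Y k) z := by
  induction z using TensorProduct.induction_on with
  | zero => simp
  | add x y hx hy => rw [map_add, map_add, map_add, map_add, map_add, ← hx, ← hy]; abel
  | tmul v w =>
    have hcomm : ∀ i j, Y i (Y j v) = Y j (Y i v) := fun i j => LinearMap.congr_fun (hY i j) v
    simp only [koszulD_tmul, koszulContraction_tmul, map_sum, LinearMap.rTensor_tmul,
      LinearMap.sum_apply, TensorProduct.sum_tmul, Module.End.mul_apply]
    rw [Finset.sum_comm, ← Finset.sum_add_distrib]
    refine Finset.sum_congr rfl fun k _ => ?_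
    rw [← Finset.sum_add_distrib, Finset.sum_eq_single k]
    · rw [← TensorProduct.tmul_add, CliffordAlgebra.contractLeft_ι_mul]
      simp
    · intro l _ hl
      rw [hcomm k l, ← TensorProduct.tmul_add, CliffordAlgebra.contractLeft_ι_mul]
      simp [hl]
    · simp

theorem koszulD_rTensor {Y : Fin κ → Module.End ℂ V} {T : Module.End ℂ V}
    (hT : ∀ k, Commute T (Y k)) (z : VLambda κ V) :
    koszulD Y (LinearMap.rTensor _ T z) = LinearMap.rTensor _ T (koszulD Y z) := by
  induction z using TensorProduct.induction_on with
  | zero => simp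
  | add x y hx hy => rw [map_add, map_add, hx, hy, map_add, map_add]
  | tmul v w =>
    have h : ∀ k, T (Y k v) = Y k (T v) := fun k => LinearMap.congr_fun (hT k) v
    simp [koszulD_tmul, h]

theorem rTensor_mem_degreePiece (T : Module.End ℂ V) {j : ℕ} {z : VLambda κ V}
    (hz : z ∈ degreePiece κ V j) : LinearMap.rTensor _ T z ∈ degreePiece κ V j := by
  obtain ⟨t, rfl⟩ := hz
  refine ⟨LinearMap.rTensor _ T t, ?_⟩
  induction t with
  | zero => simp
  | add x y hx hy => simp only [map_add, hx, hy]
  | tmul v w => simp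

theorem koszulContraction_mem_degreePiece (Y : Fin κ → Module.End ℂ V) {j : ℕ} {z : VLambda κ V}
    (hz : z ∈ degreePiece κ V (j + 1)) : koszulContraction Y z ∈ degreePiece κ V j := by
  obtain ⟨t, rfl⟩ := hz
  induction t with
  | zero => simp
  | add x y hx hy => simpa only [map_add] using Submodule.add_mem _ hx hy
  | tmul v w =>
    rw [TensorProduct.map_tmul, koszulContraction_tmul]
    exact Submodule.sum_mem _ fun k _ =>
      ⟨Y k v ⊗ₜ ⟨_, ExteriorAlgebra.contractLeft_mem_exteriorPower (LinearMap.proj k) j w.2⟩, by simp⟩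

theorem koszulContraction_eq_zero (Y : Fin κ → Module.End ℂ V) {z : VLambda κ V}
    (hz : z ∈ degreePiece κ V 0) : koszulContraction Y z = 0 := by
  obtain ⟨t, rfl⟩ := hz
  induction t with
  | zero => simp
  | add x y hx hy => simp only [map_add, hx, hy, add_zero]
  | tmul v w =>
    rw [TensorProduct.map_tmul, koszulContraction_tmul]
    refine Finset.sum_eq_zero fun k _ => ?_
    rw [Submodule.subtype_apply,
      ExteriorAlgebra.contractLeft_eq_zero_of_mem_exteriorPower_zero _ w.2,
      TensorProduct.tmul_zero]

/-- If `P = 1 - G Δ`, with `Δ = Σ Y_k²`, takes values in the joint kernel of the `Y_k`, and `G`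
commutes with every `Y_k`, then the `j`-th Koszul cohomology of `Y` has dimension
`dim (⋂ ker Y_k) * κ.choose j`. -/
theorem finrank_koszul_cohomology {Y : Fin κ → Module.End ℂ V}
    (hY : ∀ i j, Y i * Y j = Y j * Y i) {G : Module.End ℂ V} (hG : ∀ k, Commute G (Y k))
    (hP : ∀ k, Y k * (1 - G * ∑ l, Y l * Y l) = 0) (j : ℕ) :
    Module.finrank ℂ
        ((↥(degreePiece κ V j ⊓ LinearMap.ker (koszulD Y))) ⧸
          (Submodule.comap (degreePiece κ V j ⊓ LinearMap.ker (koszulD Y)).subtype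
            (if j = 0 then (⊥ : Submodule ℂ (VLambda κ V))
              else Submodule.map (koszulD Y) (degreePiece κ V (j - 1))))) =
      Module.finrank ℂ ↥(⨅ k, LinearMap.ker (Y k)) * κ.choose j := by
  set P : Module.End ℂ V := 1 - G * ∑ l, Y l * Y l with hPdef
  set K : Submodule ℂ V := ⨅ k, LinearMap.ker (Y k) with hK
  set Z := degreePiece κ V j ⊓ LinearMap.ker (koszulD Y) with hZ
  have hKmem : ∀ {v}, v ∈ K ↔ ∀ k, Y k v = 0 := by simp [hK, Submodule.mem_iInf]
  have hPY : ∀ k, Commute P (Y k) := fun k => by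
    refine (Commute.one_left _).sub_left ((hG k).mul_left ?_)
    exact Commute.sum_left _ _ _ fun l _ => Commute.mul_left (hY l k) (hY l k)
  have hPK : ∀ v, P v ∈ K := fun v => hKmem.mpr fun k => LinearMap.congr_fun (hP k) v
  have hPid : ∀ v ∈ K, P v = v := fun v hv => by
    simp [hPdef, LinearMap.sum_apply, hKmem.mp hv]
  have hPd : ∀ z, LinearMap.rTensor _ P (koszulD Y z) = 0 := fun z => by
    induction z using TensorProduct.induction_on with
    | zero => simp
    | add x y hx hy => rw [map_add, map_add, hx, hy, add_zero]
    | tmul v w =>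
      have h : ∀ k, P (Y k v) = 0 := fun k => by
        rw [← Module.End.mul_apply, (hPY k).eq, hP k, LinearMap.zero_apply]
      simp [koszulD_tmul, h]
  have hone : ∀ z : VLambda κ V, z = LinearMap.rTensor _ P z +
      LinearMap.rTensor _ G (LinearMap.rTensor _ (∑ l, Y l * Y l) z) := fun z => by
    rw [← LinearMap.comp_apply, ← LinearMap.rTensor_comp, ← LinearMap.add_apply,
      ← LinearMap.rTensor_add, ← Module.End.mul_eq_comp, hPdef, sub_add_cancel]
    simp [Module.End.one_eq_id]
  set Φ : ↥Z →ₗ[ℂ] VLambda κ V := (LinearMap.rTensor _ P) ∘ₗ Z.subtype with hΦ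
  set J := TensorProduct.map K.subtype (⋀[ℂ]^j (Fin κ → ℂ)).subtype with hJ
  have hker : Submodule.comap Z.subtype
      (if j = 0 then (⊥ : Submodule ℂ (VLambda κ V))
        else Submodule.map (koszulD Y) (degreePiece κ V (j - 1))) = LinearMap.ker Φ := by
    ext ⟨z, hzj, hzd⟩
    replace hzd : koszulD Y z = 0 := hzd
    simp only [Submodule.mem_comap, LinearMap.mem_ker, hΦ, LinearMap.comp_apply,
      Submodule.subtype_apply]
    constructor
    · intro h
      split_ifs at h with h0
      · rw [(Submodule.mem_bot ℂ).mp h, map_zero]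
      · obtain ⟨y, -, rfl⟩ := h
        exact hPd y
    · intro h
      have hz := hone z
      rw [h, zero_add, ← koszulD_koszulContraction_add hY, hzd, map_zero, add_zero,
        ← koszulD_rTensor hG] at hz
      split_ifs with h0
      · subst h0
        rw [koszulContraction_eq_zero Y hzj, map_zero, map_zero] at hz
        exact (Submodule.mem_bot ℂ).mpr hz
      · obtain ⟨i, rfl⟩ := Nat.exists_eq_succ_of_ne_zero h0
        exact ⟨_, rTensor_mem_degreePiece G (koszulContraction_mem_degreePiece Y hzj), hz.symm⟩
  have hrange : LinearMap.range Φ = LinearMap.range J := by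
    apply le_antisymm
    · rintro _ ⟨⟨z, ⟨t, rfl⟩, hzd⟩, rfl⟩
      refine ⟨LinearMap.rTensor _ (P.codRestrict K hPK) t, ?_⟩
      simp only [hΦ, hJ, LinearMap.comp_apply, Submodule.subtype_apply]
      clear hzd
      induction t with
      | zero => simp
      | add x y hx hy => simp only [map_add, hx, hy]
      | tmul v w => simp
    · rintro _ ⟨t, rfl⟩
      have h1 : J t ∈ degreePiece κ V j := by
        refine ⟨LinearMap.rTensor _ K.subtype t, ?_⟩
        induction t with
        | zero => simp
        | add x y hx hy => simp only [map_add, hx, hy]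
        | tmul v w => simp [hJ]
      have h2 : koszulD Y (J t) = 0 := by
        clear h1
        induction t with
        | zero => simp
        | add x y hx hy => simp only [map_add, hx, hy, add_zero]
        | tmul v w => simp [hJ, koszulD_tmul, hKmem.mp v.2]
      refine ⟨⟨J t, h1, h2⟩, ?_⟩
      simp only [hΦ, LinearMap.comp_apply, Submodule.subtype_apply]
      clear h1 h2
      induction t with
      | zero => simp
      | add x y hx hy => simp only [map_add, hx, hy]
      | tmul v w => simp [hJ, hPid v v.2]
  have hinj : Function.Injective J :=
    TensorProduct.map_injective_of_flat_flat _ _ K.subtype_injective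
      (Submodule.subtype_injective _)
  rw [hker, Φ.quotKerEquivRange.finrank_eq, hrange, LinearMap.finrank_range_of_inj hinj,
    Module.finrank_tensorProduct, exteriorPower.finrank_eq, Module.finrank_fin_fun]

end Koszul

/-- The kernel of `Σ T_k²` is the joint kernel of the symmetric operators `T_k`. -/
theorem LinearMap.IsSymmetric.apply_eq_zero_of_sum_mul_self_apply_eq_zero {ι V : Type*}
    [Fintype ι] [NormedAddCommGroup V] [InnerProductSpace ℂ V] {T : ι → Module.End ℂ V}
    (hT : ∀ k, LinearMap.IsSymmetric (T k)) {v : V} (hv : (∑ l, T l * T l) v = 0) (k : ι) :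
    T k v = 0 := by
  have h1 : ∑ l, ‖T l v‖ ^ 2 = 0 := by
    have h := congrArg (fun w => RCLike.re (inner ℂ v w)) hv
    simp only [LinearMap.sum_apply, Module.End.mul_apply, inner_sum, inner_zero_right,
      map_sum, map_zero, ← (hT _) v _] at h
    simpa only [inner_self_eq_norm_sq] using h
  have h2 := (Finset.sum_eq_zero_iff_of_nonneg fun l _ => sq_nonneg ‖T l v‖).mp h1 k
    (Finset.mem_univ k)
  simpa using h2

/-- Let `V` be a finite-dimensional complex inner product space and
`X₁,…,X_κ` pairwise commuting self-adjoint linear maps (`κ ≥ 1`).  Let `λ ∈ ℝ^κ` and let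
`m` be the dimension of the joint eigenspace `{v : X_k v = λ_k v ∀ k}`.  Then for each
`0 ≤ j ≤ κ` the `j`-th cohomology of the Koszul complex of `(X−λ)` has dimension
`m·C(κ,j)`; in particular the Euler characteristic is `0`. -/
theorem koszul_cohomology_selfadjoint_commuting
    {κ : ℕ} (hκ : 1 ≤ κ)
    {V : Type*} [NormedAddCommGroup V] [InnerProductSpace ℂ V] [FiniteDimensional ℂ V]
    (X : Fin κ → Module.End ℂ V)
    (hsa : ∀ k, LinearMap.IsSymmetric (X k : V →ₗ[ℂ] V))
    (hcomm : ∀ i j, X i * X j = X j * X i)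
    (lam : Fin κ → ℝ) :
    let d : VLambda κ V →ₗ[ℂ] VLambda κ V :=
      koszulD (fun k => X k - (lam k : ℂ) • 1)
    let m : ℕ := Module.finrank ℂ ↥(⨅ k, LinearMap.ker (X k - (lam k : ℂ) • 1))
    let coh : ℕ → ℕ := fun j =>
      Module.finrank ℂ
        ((↥(degreePiece κ V j ⊓ LinearMap.ker d)) ⧸
          (Submodule.comap (degreePiece κ V j ⊓ LinearMap.ker d).subtype
            (if j = 0 then (⊥ : Submodule ℂ (VLambda κ V))
              else Submodule.map d (degreePiece κ V (j - 1)))))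
    (∀ j ≤ κ, coh j = m * Nat.choose κ j) ∧
      (∑ j ∈ Finset.range (κ + 1), (-1 : ℤ) ^ j * (coh j : ℤ)) = 0 := by
  intro d m coh
  set Y : Fin κ → Module.End ℂ V := fun k => X k - (lam k : ℂ) • 1 with hYdef
  have hYsym : ∀ k, LinearMap.IsSymmetric (Y k) := fun k => by
    refine (hsa k).sub fun x y => ?_
    change inner ℂ ((lam k : ℂ) • x) y = inner ℂ x ((lam k : ℂ) • y)
    rw [inner_smul_left, inner_smul_right, Complex.conj_ofReal]
  have hYcomm : ∀ i j, Y i * Y j = Y j * Y i := fun i j => by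
    have h : Commute (X i) (X j) := hcomm i j
    exact (h.sub_left ((Commute.one_left _).smul_left _)).sub_right
      ((Commute.one_right _).smul_right _)
  have hΔsym : LinearMap.IsSymmetric (∑ l, Y l * Y l) := fun x y => by
    simp only [LinearMap.sum_apply, Module.End.mul_apply, sum_inner, inner_sum]
    exact Finset.sum_congr rfl fun l _ => by rw [hYsym l, hYsym l]
  have hss : (∑ l, Y l * Y l).IsSemisimple :=
    Module.End.isFinitelySemisimple_iff_isSemisimple.mp hΔsym.isFinitelySemisimple
  obtain ⟨g, hg⟩ := Module.End.IsSemisimple.exists_aeval_mul_eq_zero hss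
  have hG : ∀ k, Commute (Polynomial.aeval (∑ l, Y l * Y l) g) (Y k) := fun k => by
    have h : Commute (∑ l, Y l * Y l) (Y k) :=
      Commute.sum_left _ _ _ fun l _ => Commute.mul_left (hYcomm l k) (hYcomm l k)
    rw [Polynomial.aeval_eq_sum_range]
    exact Commute.sum_left _ _ _ fun i _ => (h.pow_left i).smul_left _
  have hP : ∀ k, Y k * (1 - Polynomial.aeval (∑ l, Y l * Y l) g * ∑ l, Y l * Y l) = 0 := fun k =>
    LinearMap.ext fun v =>
      LinearMap.IsSymmetric.apply_eq_zero_of_sum_mul_self_apply_eq_zero hYsym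
        (LinearMap.congr_fun hg v) k
  have hcoh : ∀ j, coh j = m * Nat.choose κ j := finrank_koszul_cohomology hYcomm hG hP
  refine ⟨fun j _ => hcoh j, ?_⟩
  have halt := Int.alternating_sum_range_choose_of_ne (Nat.one_le_iff_ne_zero.mp hκ)
  calc ∑ j ∈ Finset.range (κ + 1), (-1 : ℤ) ^ j * (coh j : ℤ)
      = (m : ℤ) * ∑ j ∈ Finset.range (κ + 1), (-1 : ℤ) ^ j * (κ.choose j : ℤ) := by
        rw [Finset.mul_sum]
        refine Finset.sum_congr rfl fun j _ => ?_
        rw [hcoh j]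
        push_cast
        ring
    _ = 0 := by rw [halt, mul_zero]
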